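/- arXiv:2407.06717 — 10 statements merged into one kernel-verified Lean document; each statement's English description precedes it below -/
import Mathlib

section
/- Let Y be a real symmetric 3×3 matrix with trace zero. Then Y has a repeated eigenvalue (i.e., its characteristic polynomial has a real root of multiplicity at least 2) if and only if there exists a real number σ such that σ²·I + σ·Y + adj(Y) = 0, where adj denotes the adjugate (matrix of cofactors). -/
open Matrix

/-- The trace of the squared adjugate of a `3 × 3` matrix, in terms of the coefficients of the
characteristic polynomial. -/
theorem trace_adjugate_mul_adjugate_fin_three {R : Type*} [CommRing R]
    (A : Matrix (Fin 3) (Fin 3) R) :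
    (A.adjugate * A.adjugate).trace = A.adjugate.trace ^ 2 - 2 * A.det * A.trace := by
  simp only [adjugate_fin_three, det_fin_three, trace_fin_three, mul_apply, Fin.sum_univ_three]
  simp
  ring

/-- A real symmetric `3 × 3` matrix has vanishing adjugate if and only if its determinant and
the trace of its adjugate vanish. -/
theorem adjugate_eq_zero_iff_of_isSymm_fin_three {A : Matrix (Fin 3) (Fin 3) ℝ} (hA : A.IsSymm) :
    A.adjugate = 0 ↔ A.det = 0 ∧ A.adjugate.trace = 0 := by
  refine ⟨fun h => ⟨?_, by simp [h]⟩, fun ⟨hdet, htr⟩ => ?_⟩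
  · simpa [h] using (congrFun₂ (mul_adjugate A) 0 0).symm
  · have hadj : A.adjugateᴴ = A.adjugate := by
      rw [conjTranspose_eq_transpose_of_trivial, adjugate_transpose, hA.eq]
    rw [← trace_conjTranspose_mul_self_eq_zero_iff, hadj, trace_adjugate_mul_adjugate_fin_three,
      hdet, htr]
    simp

/-- The adjugate of a characteristic matrix in dimension three. -/
theorem adjugate_smul_one_sub_fin_three {R : Type*} [CommRing R]
    (A : Matrix (Fin 3) (Fin 3) R) (r : R) :
    (r • (1 : Matrix (Fin 3) (Fin 3) R) - A).adjugate =
      r ^ 2 • (1 : Matrix (Fin 3) (Fin 3) R) + r • (A - A.trace • 1) + A.adjugate := by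
  ext i j
  fin_cases i <;> fin_cases j <;> simp [adjugate_fin_three, trace_fin_three] <;> ring

/-- Jacobi's formula for the characteristic polynomial in dimension three. -/
theorem eval_derivative_charpoly_fin_three {R : Type*} [CommRing R]
    (A : Matrix (Fin 3) (Fin 3) R) (r : R) :
    A.charpoly.derivative.eval r =
      (r • (1 : Matrix (Fin 3) (Fin 3) R) - A).adjugate.trace := by
  simp [charpoly, charmatrix, det_fin_three, adjugate_fin_three, trace_fin_three]
  ring

/-- a trace-free real symmetric 3×3 matrix Y has a repeated eigenvalue iff
there is σ : ℝ with σ²·I + σ·Y + adj(Y) = 0. -/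
theorem repeated_eigenvalue_iff_adjugate_condition
    (Y : Matrix (Fin 3) (Fin 3) ℝ) (hsymm : Y.IsSymm) (htr : Y.trace = 0) :
    (∃ ρ : ℝ, 2 ≤ Y.charpoly.rootMultiplicity ρ) ↔
      ∃ σ : ℝ, σ ^ 2 • (1 : Matrix (Fin 3) (Fin 3) ℝ) + σ • Y + Y.adjugate = 0 := by
  refine exists_congr fun r => ?_
  have hadj := adjugate_smul_one_sub_fin_three Y r
  rw [htr, zero_smul, sub_zero] at hadj
  have hsymm' : (r • (1 : Matrix (Fin 3) (Fin 3) ℝ) - Y).IsSymm := (isSymm_one.smul r).sub hsymm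
  rw [← hadj, adjugate_eq_zero_iff_of_isSymm_fin_three hsymm',
    ← eval_derivative_charpoly_fin_three, smul_one_eq_diagonal, ← scalar_apply, ← eval_charpoly]
  exact Polynomial.one_lt_rootMultiplicity_iff_isRoot Y.charpoly_monic.ne_zero
end

section
/- Let Y be a real symmetric 3×3 matrix with trace zero and let σ be a real number such that σ²·I + σ·Y + adj(Y) = 0. Then 3σ² + tr(adj Y) = 0, σ² = (1/6)·tr(Y²), and σ·tr(Y²) + 3·det(Y) = 0; consequently, if tr(Y²) ≠ 0 then σ = −3·det(Y)/tr(Y²) and 27·(det Y)² = (1/2)·(tr Y²)³. -/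
open Matrix

/-- The second elementary symmetric function of a `3 × 3` matrix in terms of traces. -/
lemma two_mul_trace_adjugate_fin_three {R : Type*} [CommRing R] (A : Matrix (Fin 3) (Fin 3) R) :
    2 * A.adjugate.trace = A.trace ^ 2 - (A ^ 2).trace := by
  simp only [adjugate_fin_three, trace_fin_three, pow_two, mul_apply, Fin.sum_univ_three]
  simp
  ring

/-- consequences of the adjugate condition σ²·I + σ·Y + adj(Y) = 0 for a
trace-free real symmetric 3×3 matrix Y. -/
theorem adjugate_condition_consequences
    (Y : Matrix (Fin 3) (Fin 3) ℝ) (hsymm : Y.IsSymm) (htr : Y.trace = 0) (σ : ℝ)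
    (h : σ ^ 2 • (1 : Matrix (Fin 3) (Fin 3) ℝ) + σ • Y + Y.adjugate = 0) :
    3 * σ ^ 2 + (Y.adjugate).trace = 0 ∧
    σ ^ 2 = (1 / 6) * (Y ^ 2).trace ∧
    σ * (Y ^ 2).trace + 3 * Y.det = 0 ∧
    ((Y ^ 2).trace ≠ 0 →
      σ = -3 * Y.det / (Y ^ 2).trace ∧
      27 * Y.det ^ 2 = (1 / 2) * ((Y ^ 2).trace) ^ 3) := by
  have trace_eq : 3 * σ ^ 2 + Y.adjugate.trace = 0 := by
    have := congrArg trace h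
    simp only [trace_add, trace_smul, trace_one, htr, Fintype.card_fin, trace_zero,
      smul_eq_mul] at this
    push_cast at this
    linarith
  have sq_eq : σ ^ 2 = (1 / 6) * (Y ^ 2).trace := by
    have := two_mul_trace_adjugate_fin_three Y
    rw [htr] at this
    linarith
  have det_eq : σ * (Y ^ 2).trace + 3 * Y.det = 0 := by
    have := congrArg (fun M => (Y * M).trace) h
    simp only [mul_add, mul_smul_comm, mul_one, mul_adjugate, mul_zero, ← pow_two, trace_add,
      trace_smul, trace_one, htr, Fintype.card_fin, trace_zero, smul_eq_mul] at this
    push_cast at this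
    linarith
  refine ⟨trace_eq, sq_eq, det_eq, fun hne => ⟨?_, ?_⟩⟩
  · rw [eq_div_iff hne]
    linarith
  · have hdet : 3 * Y.det = -(σ * (Y ^ 2).trace) := by linarith
    calc 27 * Y.det ^ 2 = 3 * (3 * Y.det) ^ 2 := by ring
      _ = 3 * σ ^ 2 * (Y ^ 2).trace ^ 2 := by rw [hdet]; ring
      _ = (1 / 2) * (Y ^ 2).trace ^ 3 := by rw [sq_eq]; ring
end

section
/- Let Y be a real symmetric 3×3 matrix with trace zero and let σ be a nonzero real number. Then Y² + σ·Y − 2σ²·I = 0 holds if and only if adj(Y) + σ·Y + σ²·I = 0 holds, where adj denotes the adjugate matrix. -/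
open Matrix

/-- The adjugate of a 3×3 matrix as a polynomial in the matrix; the trace of the adjugate is the
second elementary symmetric function of the eigenvalues. -/
theorem Matrix.adjugate_fin_three_eq_sq_sub {R : Type*} [CommRing R]
    (A : Matrix (Fin 3) (Fin 3) R) :
    A.adjugate = A ^ 2 - A.trace • A + A.adjugate.trace • (1 : Matrix (Fin 3) (Fin 3) R) := by
  ext i j
  fin_cases i <;> fin_cases j <;>
    simp [adjugate_fin_three, trace_fin_three, sq, mul_apply, Fin.sum_univ_three] <;> ring

/-- for a trace-free real symmetric 3×3 matrix Y and σ ≠ 0, the minimal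
polynomial condition Y² + σ·Y − 2σ²·I = 0 holds iff the adjugate condition
adj(Y) + σ·Y + σ²·I = 0 holds. -/
theorem minimal_polynomial_iff_adjugate_condition
    (Y : Matrix (Fin 3) (Fin 3) ℝ) (hsymm : Y.IsSymm) (htr : Y.trace = 0)
    (σ : ℝ) (hσ : σ ≠ 0) :
    Y ^ 2 + σ • Y - (2 * σ ^ 2) • (1 : Matrix (Fin 3) (Fin 3) ℝ) = 0 ↔
      Y.adjugate + σ • Y + σ ^ 2 • (1 : Matrix (Fin 3) (Fin 3) ℝ) = 0 := by
  have hadj := Y.adjugate_fin_three_eq_sq_sub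
  rw [htr, zero_smul, sub_zero] at hadj
  have htrace := congrArg trace hadj
  simp only [trace_add, trace_smul, trace_one, Fintype.card_fin, smul_eq_mul] at htrace
  -- Once `tr (adj Y) = -3σ²` is known, both left-hand sides are the same matrix.
  have heq (h : Y.adjugate.trace = -3 * σ ^ 2) :
      Y.adjugate + σ • Y + σ ^ 2 • (1 : Matrix (Fin 3) (Fin 3) ℝ) =
        Y ^ 2 + σ • Y - (2 * σ ^ 2) • (1 : Matrix (Fin 3) (Fin 3) ℝ) := by
    rw [h] at hadj
    rw [hadj]
    module
  constructor <;> intro h <;> have ht := congrArg trace h <;>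
    simp only [trace_add, trace_sub, trace_smul, trace_one, trace_zero, Fintype.card_fin,
      smul_eq_mul, htr] at ht <;> push_cast at ht htrace
  · rw [heq (by linarith), h]
  · rw [← heq (by linarith), h]
end

section
/- Let Y be a real symmetric 3×3 matrix with trace zero, with entries Yᵢⱼ, such that Y₁₂·Y₁₃·Y₂₃ ≠ 0, and suppose there is a real number σ with Y₁₃Y₂₃ = Y₁₂(Y₃₃ − σ), Y₁₂Y₂₃ = Y₁₃(Y₂₂ − σ), and Y₁₂Y₁₃ = Y₂₃(Y₁₁ − σ). Then Y₁₂² = (Y₁₁ − σ)(Y₂₂ − σ), Y₁₃² = (Y₁₁ − σ)(Y₃₃ − σ), Y₂₃² = (Y₂₂ − σ)(Y₃₃ − σ), and the full matrix equation Y² + σ·Y − 2σ²·I = 0 holds (so the three diagonal equations follow from the three off-diagonal ones). -/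
open Matrix

/-- for a trace-free real symmetric 3×3 matrix with nonvanishing off-diagonal
entries, the three off-diagonal minimal polynomial equations imply the diagonal ones and
the full matrix equation Y² + σ·Y − 2σ²·I = 0. -/
theorem offdiagonal_equations_imply_minimal_polynomial
    (Y : Matrix (Fin 3) (Fin 3) ℝ) (hsymm : Y.IsSymm) (htr : Y.trace = 0)
    (hne : Y 0 1 * Y 0 2 * Y 1 2 ≠ 0) (σ : ℝ)
    (h1 : Y 0 2 * Y 1 2 = Y 0 1 * (Y 2 2 - σ))
    (h2 : Y 0 1 * Y 1 2 = Y 0 2 * (Y 1 1 - σ))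
    (h3 : Y 0 1 * Y 0 2 = Y 1 2 * (Y 0 0 - σ)) :
    Y 0 1 ^ 2 = (Y 0 0 - σ) * (Y 1 1 - σ) ∧
    Y 0 2 ^ 2 = (Y 0 0 - σ) * (Y 2 2 - σ) ∧
    Y 1 2 ^ 2 = (Y 1 1 - σ) * (Y 2 2 - σ) ∧
    Y ^ 2 + σ • Y - (2 * σ ^ 2) • (1 : Matrix (Fin 3) (Fin 3) ℝ) = 0 := by
  obtain ⟨⟨ha, hb⟩, hc⟩ : (Y 0 1 ≠ 0 ∧ Y 0 2 ≠ 0) ∧ Y 1 2 ≠ 0 := by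
    simpa only [mul_ne_zero_iff] using hne
  have h01 : Y 0 1 ^ 2 = (Y 0 0 - σ) * (Y 1 1 - σ) := by
    apply mul_left_cancel₀ (mul_ne_zero hb hc)
    linear_combination Y 0 1 * Y 0 2 * h2 + Y 0 2 * (Y 1 1 - σ) * h3
  have h02 : Y 0 2 ^ 2 = (Y 0 0 - σ) * (Y 2 2 - σ) := by
    apply mul_left_cancel₀ (mul_ne_zero ha hc)
    linear_combination Y 0 1 * Y 0 2 * h1 + Y 0 1 * (Y 2 2 - σ) * h3
  have h12 : Y 1 2 ^ 2 = (Y 1 1 - σ) * (Y 2 2 - σ) := by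
    apply mul_left_cancel₀ (mul_ne_zero ha hb)
    linear_combination Y 0 1 * Y 1 2 * h1 + Y 0 1 * (Y 2 2 - σ) * h2
  refine ⟨h01, h02, h12, ?_⟩
  have s10 : Y 1 0 = Y 0 1 := hsymm.apply 0 1
  have s20 : Y 2 0 = Y 0 2 := hsymm.apply 0 2
  have s21 : Y 2 1 = Y 1 2 := hsymm.apply 1 2
  rw [Matrix.trace_fin_three] at htr
  ext i j
  fin_cases i <;> fin_cases j <;>
    simp [pow_two Y, Matrix.mul_apply, Fin.sum_univ_three, s10, s20, s21]
  · linear_combination h01 + h02 + (Y 0 0 - σ) * htr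
  · linear_combination h1 + Y 0 1 * htr
  · linear_combination h2 + Y 0 2 * htr
  · linear_combination h1 + Y 0 1 * htr
  · linear_combination h01 + h12 + (Y 1 1 - σ) * htr
  · linear_combination h3 + Y 1 2 * htr
  · linear_combination h2 + Y 0 2 * htr
  · linear_combination h3 + Y 1 2 * htr
  · linear_combination h02 + h12 + (Y 2 2 - σ) * htr
end

section
/- Let Y be a real symmetric 3×3 matrix with trace zero, with entries Yᵢⱼ, that has a repeated eigenvalue. Then the three Khatkevich polynomials vanish: R₁ = (Y₁₁ − Y₂₂)Y₁₃Y₂₃ − Y₁₂(Y₁₃² − Y₂₃²) = 0, R₂ = (Y₁₁ − Y₃₃)Y₁₂Y₂₃ − Y₁₃(Y₁₂² − Y₂₃²) = 0, and R₃ = (Y₂₂ − Y₃₃)Y₁₂Y₁₃ − Y₂₃(Y₁₂² − Y₁₃²) = 0. -/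
open Matrix

/-- For a singular real symmetric 3×3 matrix with diagonal `a, b, c` and off-diagonal entries
`d, e, f` whose principal 2×2 minors sum to zero, the off-diagonal cofactors vanish. -/
lemma offDiag_cofactors_eq_zero {a b c d e f : ℝ}
    (hdet : a * b * c + 2 * d * e * f - a * f ^ 2 - b * e ^ 2 - c * d ^ 2 = 0)
    (hminors : a * b + a * c + b * c - d ^ 2 - e ^ 2 - f ^ 2 = 0) :
    a * f - d * e = 0 ∧ b * e - d * f = 0 ∧ c * d - e * f = 0 := by
  -- The cofactor matrix has trace zero and rank at most one, so its Frobenius norm is zero.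
  have hsum : (b * c - f ^ 2) ^ 2 + (a * c - e ^ 2) ^ 2 + (a * b - d ^ 2) ^ 2 +
      2 * ((a * f - d * e) ^ 2 + (b * e - d * f) ^ 2 + (c * d - e * f) ^ 2) = 0 := by
    linear_combination (a * b + a * c + b * c - d ^ 2 - e ^ 2 - f ^ 2) * hminors -
      2 * (a + b + c) * hdet
  refine ⟨?_, ?_, ?_⟩ <;> refine pow_eq_zero_iff two_ne_zero |>.mp ?_ <;>
    linarith [sq_nonneg (b * c - f ^ 2), sq_nonneg (a * c - e ^ 2), sq_nonneg (a * b - d ^ 2),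
      sq_nonneg (a * f - d * e), sq_nonneg (b * e - d * f), sq_nonneg (c * d - e * f)]

/-- a trace-free real symmetric 3×3 matrix with a repeated eigenvalue
satisfies the three Khatkevich polynomial conditions. -/
theorem khatkevich_conditions
    (Y : Matrix (Fin 3) (Fin 3) ℝ) (hsymm : Y.IsSymm) (htr : Y.trace = 0)
    (hrep : ∃ ρ : ℝ, 2 ≤ Y.charpoly.rootMultiplicity ρ) :
    (Y 0 0 - Y 1 1) * Y 0 2 * Y 1 2 - Y 0 1 * (Y 0 2 ^ 2 - Y 1 2 ^ 2) = 0 ∧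
    (Y 0 0 - Y 2 2) * Y 0 1 * Y 1 2 - Y 0 2 * (Y 0 1 ^ 2 - Y 1 2 ^ 2) = 0 ∧
    (Y 1 1 - Y 2 2) * Y 0 1 * Y 0 2 - Y 1 2 * (Y 0 1 ^ 2 - Y 0 2 ^ 2) = 0 := by
  obtain ⟨ρ, hρ⟩ := hrep
  obtain ⟨hroot, hderiv⟩ :=
    (Polynomial.one_lt_rootMultiplicity_iff_isRoot Y.charpoly_monic.ne_zero).mp hρ
  have h10 : Y 1 0 = Y 0 1 := hsymm.apply 0 1
  have h20 : Y 2 0 = Y 0 2 := hsymm.apply 0 2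
  have h21 : Y 2 1 = Y 1 2 := hsymm.apply 1 2
  simp [Polynomial.IsRoot, Matrix.charpoly, Matrix.det_fin_three, h10, h20, h21]
    at hroot hderiv
  obtain ⟨h₁, h₂, h₃⟩ := offDiag_cofactors_eq_zero
    (a := Y 0 0 - ρ) (b := Y 1 1 - ρ) (c := Y 2 2 - ρ) (d := Y 0 1) (e := Y 0 2) (f := Y 1 2)
    (by linear_combination -hroot) (by linear_combination hderiv)
  refine ⟨?_, ?_, ?_⟩
  · linear_combination Y 0 2 * h₁ - Y 1 2 * h₂
  · linear_combination Y 0 1 * h₁ - Y 1 2 * h₃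
  · linear_combination Y 0 1 * h₂ - Y 0 2 * h₃
end

section
/- Let Y be a real symmetric 3×3 matrix with trace zero, with entries Yᵢⱼ, that has a repeated eigenvalue. Then the four Alshits–Lothe polynomials vanish: R₄ = (Y₁₁ − Y₂₂)(Y₁₁ − Y₃₃)Y₂₃ − (Y₁₁ − Y₃₃)Y₁₂Y₁₃ + Y₂₃(Y₁₂² − Y₂₃²) = 0, R₅ = (Y₂₂ − Y₁₁)(Y₂₂ − Y₃₃)Y₁₃ − (Y₂₂ − Y₃₃)Y₁₂Y₂₃ + Y₁₃(Y₁₂² − Y₁₃²) = 0, R₆ = (Y₃₃ − Y₁₁)(Y₃₃ − Y₂₂)Y₁₂ − (Y₃₃ − Y₂₂)Y₁₃Y₂₃ + Y₁₂(Y₁₃² − Y₁₂²) = 0, and R₇ = (Y₁₁ − Y₂₂)(Y₂₂ − Y₃₃)(Y₁₁ − Y₃₃) + (Y₂₂ − Y₃₃)(Y₁₃² − Y₂₃²) + (Y₁₁ − Y₂₂)(Y₁₃² − Y₁₂²) = 0. -/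
open Matrix

/-- The `2 × 2` minors of a singular real symmetric `3 × 3` matrix with diagonal `p, q, r` and
off-diagonal entries `a, b, c` all vanish as soon as its principal ones sum to zero. -/
lemma symm_three_minors_eq_zero {p q r a b c : ℝ}
    (hdet : p * q * r + 2 * a * b * c - p * c ^ 2 - q * b ^ 2 - r * a ^ 2 = 0)
    (hsum : (p * q - a ^ 2) + (p * r - b ^ 2) + (q * r - c ^ 2) = 0) :
    p * q - a ^ 2 = 0 ∧ p * r - b ^ 2 = 0 ∧ q * r - c ^ 2 = 0 ∧
      p * c - a * b = 0 ∧ q * b - a * c = 0 ∧ r * a - b * c = 0 := by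
  have hsq : (p * q - a ^ 2) ^ 2 + (p * r - b ^ 2) ^ 2 + (q * r - c ^ 2) ^ 2
      + 2 * (p * c - a * b) ^ 2 + 2 * (q * b - a * c) ^ 2 + 2 * (r * a - b * c) ^ 2 = 0 := by
    linear_combination ((p * q - a ^ 2) + (p * r - b ^ 2) + (q * r - c ^ 2)) * hsum
      - 2 * (p + q + r) * hdet
  refine ⟨?_, ?_, ?_, ?_, ?_, ?_⟩ <;> refine pow_eq_zero_iff two_ne_zero |>.mp ?_ <;>
    linarith [sq_nonneg (p * q - a ^ 2), sq_nonneg (p * r - b ^ 2), sq_nonneg (q * r - c ^ 2),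
      sq_nonneg (p * c - a * b), sq_nonneg (q * b - a * c), sq_nonneg (r * a - b * c)]

/-- a trace-free real symmetric 3×3 matrix with a repeated eigenvalue
satisfies the four Alshits–Lothe polynomial conditions R₄, R₅, R₆, R₇. -/
theorem alshits_lothe_conditions
    (Y : Matrix (Fin 3) (Fin 3) ℝ) (hsymm : Y.IsSymm) (htr : Y.trace = 0)
    (hrep : ∃ ρ : ℝ, 2 ≤ Y.charpoly.rootMultiplicity ρ) :
    (Y 0 0 - Y 1 1) * (Y 0 0 - Y 2 2) * Y 1 2 - (Y 0 0 - Y 2 2) * Y 0 1 * Y 0 2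
      + Y 1 2 * (Y 0 1 ^ 2 - Y 1 2 ^ 2) = 0 ∧
    (Y 1 1 - Y 0 0) * (Y 1 1 - Y 2 2) * Y 0 2 - (Y 1 1 - Y 2 2) * Y 0 1 * Y 1 2
      + Y 0 2 * (Y 0 1 ^ 2 - Y 0 2 ^ 2) = 0 ∧
    (Y 2 2 - Y 0 0) * (Y 2 2 - Y 1 1) * Y 0 1 - (Y 2 2 - Y 1 1) * Y 0 2 * Y 1 2
      + Y 0 1 * (Y 0 2 ^ 2 - Y 0 1 ^ 2) = 0 ∧
    (Y 0 0 - Y 1 1) * (Y 1 1 - Y 2 2) * (Y 0 0 - Y 2 2)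
      + (Y 1 1 - Y 2 2) * (Y 0 2 ^ 2 - Y 1 2 ^ 2)
      + (Y 0 0 - Y 1 1) * (Y 0 2 ^ 2 - Y 0 1 ^ 2) = 0 := by
  obtain ⟨ρ, hρ⟩ := hrep
  have h10 : Y 1 0 = Y 0 1 := hsymm.apply 0 1
  have h20 : Y 2 0 = Y 0 2 := hsymm.apply 0 2
  have h21 : Y 2 1 = Y 1 2 := hsymm.apply 1 2
  obtain ⟨hroot, hroot'⟩ :=
    (Polynomial.one_lt_rootMultiplicity_iff_isRoot Y.charpoly_monic.ne_zero).mp hρ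
  simp [Polynomial.IsRoot, Matrix.charpoly, Matrix.det_fin_three, h10, h20, h21] at hroot hroot'
  obtain ⟨hpq, hpr, hqr, hpc, hqb, hra⟩ := symm_three_minors_eq_zero
    (p := Y 0 0 - ρ) (q := Y 1 1 - ρ) (r := Y 2 2 - ρ) (a := Y 0 1) (b := Y 0 2) (c := Y 1 2)
    (by linear_combination -hroot) (by linear_combination hroot')
  refine ⟨?_, ?_, ?_, ?_⟩
  · linear_combination (Y 0 0 - Y 2 2) * hpc - Y 1 2 * hpq + Y 1 2 * hqr
  · linear_combination (Y 1 1 - Y 2 2) * hqb - Y 0 2 * hpq + Y 0 2 * hpr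
  · linear_combination (Y 2 2 - Y 1 1) * hra - Y 0 1 * hpr + Y 0 1 * hpq
  · linear_combination (Y 1 1 - Y 2 2) * (hqr - hpr) + (Y 0 0 - Y 1 1) * (hpq - hpr)
end

section
/- Let Y be a real symmetric 3×3 matrix with trace zero, with entries Yᵢⱼ, such that Y₁₃ = Y₂₃ = 0 and Y₁₂ ≠ 0, and suppose Y² + σ·Y − 2σ²·I = 0 for some real number σ. Then Y₃₃ = σ and (Y₃₃ − Y₁₁)(Y₃₃ − Y₂₂) = Y₁₂². -/
open Matrix

/-- if Y₁₃ = Y₂₃ = 0, Y₁₂ ≠ 0 and Y satisfies the minimal polynomial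
condition, then Y₃₃ = σ and (Y₃₃ − Y₁₁)(Y₃₃ − Y₂₂) = Y₁₂². -/
theorem exceptional_case_two_zero_offdiagonal
    (Y : Matrix (Fin 3) (Fin 3) ℝ) (hsymm : Y.IsSymm) (htr : Y.trace = 0)
    (h13 : Y 0 2 = 0) (h23 : Y 1 2 = 0) (h12 : Y 0 1 ≠ 0) (σ : ℝ)
    (h : Y ^ 2 + σ • Y - (2 * σ ^ 2) • (1 : Matrix (Fin 3) (Fin 3) ℝ) = 0) :
    Y 2 2 = σ ∧ (Y 2 2 - Y 0 0) * (Y 2 2 - Y 1 1) = Y 0 1 ^ 2 := by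
  have h10 : Y 1 0 = Y 0 1 := hsymm.apply 0 1
  have h20 : Y 2 0 = 0 := (hsymm.apply 0 2).trans h13
  have e00 := congrFun (congrFun h 0) 0
  have e01 := congrFun (congrFun h 0) 1
  simp [pow_two, Matrix.mul_apply, Fin.sum_univ_three, h10, h13, h20] at e00 e01
  rw [Matrix.trace_fin_three] at htr
  have hsum : Y 0 0 + Y 1 1 + σ = 0 := by
    refine (mul_eq_zero.mp ?_).resolve_left h12
    linear_combination e01
  have h22 : Y 2 2 = σ := by linear_combination htr - hsum
  refine ⟨h22, ?_⟩
  have h11 : Y 1 1 = -σ - Y 0 0 := by linear_combination hsum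
  rw [h22, h11]
  linear_combination -e00
end

section
/- Let Γ be a real symmetric 3×3 matrix. Then Γ has a repeated eigenvalue (its characteristic polynomial has a real root of multiplicity at least 2) if and only if det[m, Γm, Γ²m] = 0 for every vector m ∈ ℝ³, where det[a, b, c] denotes the determinant of the 3×3 matrix with columns a, b, c. (This is the Norris uniaxiality criterion.) -/
open Matrix

/-- If `A * P = P * diagonal d`, then the Krylov matrix of `A` at `P *ᵥ c` factors through the
Vandermonde matrix of `d`. -/
lemma Matrix.krylov_eq_mul_vandermonde {R : Type*} [CommRing R] {n : ℕ}
    {A P : Matrix (Fin n) (Fin n) R} {d : Fin n → R} (h : A * P = P * diagonal d)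
    (c : Fin n → R) :
    (Matrix.of fun k : Fin n => (A ^ (k : ℕ)) *ᵥ (P *ᵥ c))ᵀ =
      P * (diagonal c * vandermonde d) := by
  have hpow (k : ℕ) : A ^ k * P = P * diagonal (d ^ k) := by
    rw [← diagonal_pow]
    exact (SemiconjBy.pow_right (a := P) (x := diagonal d) (y := A) h.symm k).symm
  ext i k
  rw [transpose_apply, of_apply, mulVec_mulVec, hpow, ← mulVec_mulVec]
  simp only [mulVec, dotProduct, mul_apply, vandermonde_apply]
  refine Finset.sum_congr rfl fun j _ => ?_
  congr 1
  simp [diagonal_apply, mul_comm]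

/-- A Hermitian real matrix has a multiple root of its characteristic polynomial iff its
eigenvalue family is not injective. -/
lemma Matrix.IsHermitian.exists_two_le_rootMultiplicity_charpoly_iff {n : Type*} [Fintype n]
    [DecidableEq n] {A : Matrix n n ℝ} (hA : A.IsHermitian) :
    (∃ ρ : ℝ, 2 ≤ A.charpoly.rootMultiplicity ρ) ↔ ¬ Function.Injective hA.eigenvalues := by
  have hroots : A.charpoly.roots = Multiset.map hA.eigenvalues Finset.univ.val :=
    hA.roots_charpoly_eq_eigenvalues
  have hnodup : A.charpoly.roots.Nodup ↔ Function.Injective hA.eigenvalues := by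
    rw [hroots, Multiset.nodup_map_iff_inj_on Finset.univ.nodup]
    simp [Function.Injective]
  rw [← hnodup, Multiset.nodup_iff_count_le_one]
  simp [Polynomial.count_roots, Nat.succ_le_iff]

/-- Norris criterion: a real symmetric 3×3 matrix Γ has a repeated
eigenvalue iff det[m, Γm, Γ²m] = 0 for every m ∈ ℝ³. -/
theorem norris_uniaxiality_criterion
    (Γ : Matrix (Fin 3) (Fin 3) ℝ) (hsymm : Γ.IsSymm) :
    (∃ ρ : ℝ, 2 ≤ Γ.charpoly.rootMultiplicity ρ) ↔
      ∀ m : Fin 3 → ℝ, ((Matrix.of ![m, Γ.mulVec m, (Γ ^ 2).mulVec m])ᵀ).det = 0 := by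
  have hΓ : Γ.IsHermitian := by rwa [IsHermitian, conjTranspose_eq_transpose_of_trivial]
  rw [hΓ.exists_two_le_rootMultiplicity_charpoly_iff, ← det_vandermonde_ne_zero_iff, not_not]
  let P : Matrix (Fin 3) (Fin 3) ℝ := hΓ.eigenvectorUnitary.val
  have hPP : P * star P = 1 := Unitary.coe_mul_star_self hΓ.eigenvectorUnitary
  have hPP' : star P * P = 1 := Unitary.coe_star_mul_self hΓ.eigenvectorUnitary
  have hdiag : Γ * P = P * diagonal hΓ.eigenvalues := by
    have h : Γ = P * diagonal hΓ.eigenvalues * star P := by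
      simpa [Unitary.conjStarAlgAut_apply] using hΓ.spectral_theorem
    conv_lhs => rw [h]
    rw [mul_assoc, hPP', mul_one]
  have hdet (c : Fin 3 → ℝ) :
      ((Matrix.of ![P *ᵥ c, Γ *ᵥ (P *ᵥ c), (Γ ^ 2) *ᵥ (P *ᵥ c)])ᵀ).det =
        P.det * ((∏ i, c i) * (vandermonde hΓ.eigenvalues).det) := by
    rw [← det_diagonal, ← det_mul, ← det_mul, ← krylov_eq_mul_vandermonde hdiag]
    congr 2
    ext k : 2
    fin_cases k <;> simp
  constructor
  · intro h m
    have hm : P *ᵥ (star P *ᵥ m) = m := by rw [mulVec_mulVec, hPP, one_mulVec]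
    rw [← hm, hdet, h, mul_zero, mul_zero]
  · intro h
    have hPdet : P.det ≠ 0 := det_ne_zero_of_right_inverse hPP
    simpa [hPdet] using (hdet 1).symm.trans (h (P *ᵥ 1))
end

section
/- Let Y be a real symmetric 3×3 matrix with trace zero. Then the discriminant condition 2·(det Y)² = ((1/3)·tr(Y²))³ holds if and only if there exists a real number σ such that the minimal-polynomial condition Y² + σ·Y − 2σ²·I = 0 holds. -/
open Matrix

/-- The Cayley–Hamilton identity for a trace-free `3 × 3` matrix. -/
theorem pow_three_of_trace_eq_zero {Y : Matrix (Fin 3) (Fin 3) ℝ} (htr : Y.trace = 0) :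
    Y ^ 3 = ((Y ^ 2).trace / 2) • Y + Y.det • (1 : Matrix (Fin 3) (Fin 3) ℝ) := by
  have h : Y 2 2 = -Y 0 0 - Y 1 1 := by
    rw [Matrix.trace_fin_three] at htr
    linarith
  ext i j
  fin_cases i <;> fin_cases j <;>
    simp [pow_succ, Matrix.mul_apply, Fin.sum_univ_three, Matrix.trace_fin_three,
      Matrix.det_fin_three, h] <;> ring

theorem Matrix.IsSymm.eq_zero_of_mul_self_eq_zero {n : Type*} [Fintype n]
    {M : Matrix n n ℝ} (hM : M.IsSymm) (h : M * M = 0) : M = 0 := by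
  rw [← Matrix.self_mul_conjTranspose_eq_zero, Matrix.conjTranspose_eq_transpose_of_trivial,
    hM.eq, h]

theorem Matrix.IsSymm.eq_zero_of_trace_sq_eq_zero {n : Type*} [Fintype n] [DecidableEq n]
    {M : Matrix n n ℝ} (hM : M.IsSymm) (h : (M ^ 2).trace = 0) : M = 0 := by
  rw [← Matrix.trace_mul_conjTranspose_self_eq_zero_iff,
    Matrix.conjTranspose_eq_transpose_of_trivial, hM.eq, ← pow_two, h]

/-- for a trace-free real symmetric 3×3 matrix Y, the discriminant condition
2 (det Y)² = ((1/3) tr Y²)³ holds iff the minimal polynomial condition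
Y² + σ·Y − 2σ²·I = 0 holds for some real σ. -/
theorem discriminant_iff_minimal_polynomial
    (Y : Matrix (Fin 3) (Fin 3) ℝ) (hsymm : Y.IsSymm) (htr : Y.trace = 0) :
    2 * Y.det ^ 2 = ((1 / 3) * (Y ^ 2).trace) ^ 3 ↔
      ∃ σ : ℝ, Y ^ 2 + σ • Y - (2 * σ ^ 2) • (1 : Matrix (Fin 3) (Fin 3) ℝ) = 0 := by
  have hCH := pow_three_of_trace_eq_zero htr
  constructor
  · intro hdisc
    by_cases ht : (Y ^ 2).trace = 0
    · exact ⟨0, by simp [hsymm.eq_zero_of_trace_sq_eq_zero ht]⟩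
    obtain ⟨σ, hσ⟩ : ∃ σ : ℝ, σ * (Y ^ 2).trace = -3 * Y.det :=
      ⟨-3 * Y.det / (Y ^ 2).trace, div_mul_cancel₀ _ ht⟩
    have htσ : (Y ^ 2).trace = 6 * σ ^ 2 := by
      apply mul_right_cancel₀ (pow_ne_zero 2 ht)
      linear_combination (-6 * (σ * (Y ^ 2).trace - 3 * Y.det)) * hσ - 27 * hdisc
    have hdσ : Y.det = -2 * σ ^ 3 := by
      rw [htσ] at hσ
      linear_combination (1 / 3) * hσ
    rw [htσ, hdσ] at hCH
    refine ⟨σ, Matrix.IsSymm.eq_zero_of_mul_self_eq_zero ?_ ?_⟩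
    · exact ((hsymm.pow 2).add (hsymm.smul σ)).sub (Matrix.isSymm_one.smul _)
    · have hfactor : (Y ^ 2 + σ • Y - (2 * σ ^ 2) • (1 : Matrix (Fin 3) (Fin 3) ℝ)) *
          (Y ^ 2 + σ • Y - (2 * σ ^ 2) • 1) =
          (Y + (2 * σ) • 1) * (Y ^ 3 - ((6 * σ ^ 2 / 2) • Y + (-2 * σ ^ 3) • 1)) := by
        simp only [mul_add, add_mul, mul_sub, sub_mul, smul_mul_assoc, mul_smul_comm,
          mul_one, one_mul, pow_succ, pow_zero, mul_assoc]
        module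
      rw [hfactor, ← hCH, sub_self, mul_zero]
  · rintro ⟨σ, h⟩
    have htσ : (Y ^ 2).trace = 6 * σ ^ 2 := by
      have := congrArg Matrix.trace h
      simp [htr] at this
      linarith
    have hcube : Y ^ 3 = (3 * σ ^ 2) • Y - (2 * σ ^ 3) • (1 : Matrix (Fin 3) (Fin 3) ℝ) := by
      have hY : Y ^ 2 = (2 * σ ^ 2) • (1 : Matrix (Fin 3) (Fin 3) ℝ) - σ • Y := by
        rw [← sub_eq_zero, ← h]
        abel
      rw [pow_succ, hY, sub_mul, smul_mul_assoc, smul_mul_assoc, one_mul, ← pow_two, hY]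
      module
    have hdσ : Y.det = -2 * σ ^ 3 := by
      have := congrArg Matrix.trace (hCH.symm.trans hcube)
      simp [htr] at this
      linarith
    rw [htσ, hdσ]
    ring
end

section
/- Let Y be a real symmetric 3×3 matrix with trace zero. Then Y has a repeated eigenvalue (its characteristic polynomial has a real root of multiplicity at least 2) if and only if there exist a real number σ and a unit vector q ∈ ℝ³ such that Y = σ·(I − 3·q qᵀ). Moreover, in that case Y q = −2σ·q, so q is an eigenvector of Y for the eigenvalue −2σ. -/
open Matrix

namespace Matrix

open Polynomial in
/-- The matrix `σ (I − 3 q qᵀ)`, for a unit vector `q`, has characteristic polynomial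
`(X − σ)² (X + 2σ)`. -/
theorem charpoly_smul_one_sub_three_smul_vecMulVec (σ : ℝ) (q : Fin 3 → ℝ) (hq : q ⬝ᵥ q = 1) :
    (σ • ((1 : Matrix (Fin 3) (Fin 3) ℝ) - (3 : ℝ) • vecMulVec q q)).charpoly =
      (X - C σ) ^ 2 * (X + C (2 * σ)) := by
  have hC : C (q 0) * C (q 0) + C (q 1) * C (q 1) + C (q 2) * C (q 2) = 1 := by
    rw [← C_1, ← hq]
    simp [dotProduct, Fin.sum_univ_three]
  simp [charpoly, det_fin_three, vecMulVec_apply, show (C 3 : ℝ[X]) = 3 from rfl,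
    show (C 2 : ℝ[X]) = 2 from rfl]
  linear_combination 3 * C σ * (X - C σ) ^ 2 * hC

/-- A root of multiplicity at least two of the characteristic polynomial of a Hermitian matrix
is an eigenvalue at two distinct indices. -/
theorem IsHermitian.exists_ne_eigenvalues_eq_of_two_le_rootMultiplicity {n : Type*} [Fintype n]
    [DecidableEq n] {A : Matrix n n ℝ} (hA : A.IsHermitian) {ρ : ℝ}
    (h : 2 ≤ A.charpoly.rootMultiplicity ρ) :
    ∃ i j, i ≠ j ∧ hA.eigenvalues i = ρ ∧ hA.eigenvalues j = ρ := by
  rw [← Polynomial.count_roots, hA.roots_charpoly_eq_eigenvalues, Multiset.count_map] at h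
  obtain ⟨i, hi, j, hj, hij⟩ :=
    Finset.one_lt_card.mp (show 1 < (Finset.univ.filter fun i => ρ = hA.eigenvalues i).card from h)
  simp only [Finset.mem_filter, Finset.mem_univ, true_and] at hi hj
  exact ⟨i, j, hij, hi.symm, hj.symm⟩

/-- A real Hermitian matrix whose eigenvalues away from the index `k` all equal `ρ` is a rank-one
perturbation of `ρ I`. -/
theorem IsHermitian.eq_smul_one_add_smul_vecMulVec {n : Type*} [Fintype n] [DecidableEq n]
    {A : Matrix n n ℝ} (hA : A.IsHermitian) {ρ : ℝ} {k : n}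
    (h : ∀ i, i ≠ k → hA.eigenvalues i = ρ) :
    A = ρ • (1 : Matrix n n ℝ) + (hA.eigenvalues k - ρ) •
      vecMulVec (hA.eigenvectorBasis k) (hA.eigenvectorBasis k) := by
  let U : Matrix n n ℝ := (hA.eigenvectorUnitary).1
  have hUU : U * star U = 1 := Unitary.coe_mul_star_self hA.eigenvectorUnitary
  have hD : diagonal hA.eigenvalues =
      ρ • (1 : Matrix n n ℝ) + (hA.eigenvalues k - ρ) •
        vecMulVec (Pi.single k 1) (Pi.single k 1) := by
    ext i j
    rcases eq_or_ne i j with rfl | hij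
    · rcases eq_or_ne i k with rfl | hik
      · simp [vecMulVec_apply]
      · simp [vecMulVec_apply, hik, h i hik]
    · rcases eq_or_ne i k with rfl | hik
      · simp [vecMulVec_apply, hij, hij.symm]
      · simp [vecMulVec_apply, hij, hik]
  have hcol : U *ᵥ Pi.single k 1 = hA.eigenvectorBasis k := hA.eigenvectorUnitary_mulVec k
  have hrow : Pi.single k 1 ᵥ* star U = hA.eigenvectorBasis k := by
    rw [← hcol, star_eq_conjTranspose, conjTranspose_eq_transpose_of_trivial, vecMul_transpose]
  have hspec : A = U * diagonal hA.eigenvalues * star U := by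
    conv_lhs => rw [hA.spectral_theorem]
    rfl
  rw [hD, mul_add, add_mul, mul_smul_comm, mul_smul_comm, smul_mul_assoc, smul_mul_assoc, mul_one,
    hUU, mul_vecMulVec, vecMulVec_mul, hcol, hrow] at hspec
  exact hspec

end Matrix

/-- polarization vector condition: a trace-free real symmetric 3×3 matrix Y
has a repeated eigenvalue iff Y = σ (I − 3 q qᵀ) for some σ : ℝ and unit vector q;
moreover, in that case Y q = −2σ q. -/
theorem polarization_vector_condition
    (Y : Matrix (Fin 3) (Fin 3) ℝ) (hsymm : Y.IsSymm) (htr : Y.trace = 0) :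
    ((∃ ρ : ℝ, 2 ≤ Y.charpoly.rootMultiplicity ρ) ↔
      ∃ (σ : ℝ) (q : Fin 3 → ℝ), q ⬝ᵥ q = 1 ∧
        Y = σ • ((1 : Matrix (Fin 3) (Fin 3) ℝ) - (3 : ℝ) • Matrix.vecMulVec q q)) ∧
    (∀ (σ : ℝ) (q : Fin 3 → ℝ), q ⬝ᵥ q = 1 →
      Y = σ • ((1 : Matrix (Fin 3) (Fin 3) ℝ) - (3 : ℝ) • Matrix.vecMulVec q q) →
      Y.mulVec q = (-2 * σ) • q) := by
  refine ⟨⟨?_, ?_⟩, ?_⟩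
  · rintro ⟨ρ, hρ⟩
    have hA : Y.IsHermitian := hsymm
    obtain ⟨i, j, hij, hi, hj⟩ := hA.exists_ne_eigenvalues_eq_of_two_le_rootMultiplicity hρ
    obtain ⟨k, hki, hkj, hk⟩ : ∃ k, k ≠ i ∧ k ≠ j ∧ ∀ l, l ≠ k → l = i ∨ l = j := by
      clear hi hj
      decide +revert
    have hne : ∀ l, l ≠ k → hA.eigenvalues l = ρ := by
      intro l hl
      rcases hk l hl with rfl | rfl <;> assumption
    have hsum : hA.eigenvalues k + 2 * ρ = 0 := by
      have hsplit := Finset.add_sum_erase Finset.univ hA.eigenvalues (Finset.mem_univ k)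
      rw [Finset.sum_congr rfl fun l hl => hne l (Finset.ne_of_mem_erase hl)] at hsplit
      have htrace := hA.trace_eq_sum_eigenvalues
      simp_all
    refine ⟨ρ, hA.eigenvectorBasis k, ?_, ?_⟩
    · have hinner := real_inner_self_eq_norm_sq (hA.eigenvectorBasis k)
      rwa [EuclideanSpace.inner_eq_star_dotProduct, star_trivial,
        hA.eigenvectorBasis.orthonormal.1 k, one_pow] at hinner
    · have hY := hA.eq_smul_one_add_smul_vecMulVec hne
      rw [show hA.eigenvalues k - ρ = -(ρ * 3) by linarith] at hY
      rw [smul_sub, smul_smul, sub_eq_add_neg, ← neg_smul]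
      exact hY
  · rintro ⟨σ, q, hq, rfl⟩
    refine ⟨σ, ?_⟩
    rw [Polynomial.le_rootMultiplicity_iff (charpoly_monic _).ne_zero,
      charpoly_smul_one_sub_three_smul_vecMulVec σ q hq]
    exact dvd_mul_right _ _
  · rintro σ q hq rfl
    rw [smul_mulVec, sub_mulVec, one_mulVec, smul_mulVec, vecMulVec_mulVec, hq]
    ext i
    simp
    ring
end
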